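/- There exists a ternary word of length 537 avoiding 2-abelian squares (e.g., the word beginning abcbabcacbacabacbabcbacabcbabcabacabcacbacabacbabcbacbcacbabcacbcabcba…). -/

import Mathlib

/-- Number of occurrences of `w` as a factor (contiguous subword) of `u`. -/
def countOcc {α : Type*} [DecidableEq α] (w u : List α) : ℕ :=
  u.tails.countP (fun t => w.isPrefixOf t)

/-- `k`-abelian equivalence: same prefix and suffix of length `k-1`
(truncated to the words' lengths) and same number of occurrences of
every factor of length `k`. -/
def KAbEq {α : Type*} [DecidableEq α] (k : ℕ) (u v : List α) : Prop :=
  u.take (k - 1) = v.take (k - 1) ∧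
  u.drop (u.length - (k - 1)) = v.drop (v.length - (k - 1)) ∧
  ∀ w : List α, w.length = k → countOcc w u = countOcc w v

/-- The sum of `f a b` over all pairs `a, b` of consecutive letters of a word. -/
def pairWeight {α : Type*} (f : α → α → ℕ) : List α → ℕ
  | [] => 0
  | [_] => 0
  | a :: b :: t => f a b + pairWeight f (b :: t)

theorem pairWeight_append_cons {α : Type*} (f : α → α → ℕ) (s : α) (v : List α) :
    ∀ u : List α, pairWeight f (u ++ s :: v) = pairWeight f (u ++ [s]) + pairWeight f (s :: v)
  | [] => by simp [pairWeight]
  | [a] => by simp [pairWeight]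
  | a :: b :: u => by
    have := pairWeight_append_cons f s v (b :: u)
    simp only [List.cons_append, pairWeight] at this ⊢
    omega

theorem pairWeight_one {α : Type*} :
    ∀ u : List α, pairWeight (fun _ _ => 1) u = u.length - 1
  | [] => rfl
  | [_] => rfl
  | a :: b :: u => by
    have := pairWeight_one (b :: u)
    simp only [List.length_cons, pairWeight] at this ⊢
    omega

theorem countOcc_cons {α : Type*} [DecidableEq α] (w : List α) (a : α) (t : List α) :
    countOcc w (a :: t) = countOcc w t + if w.isPrefixOf (a :: t) then 1 else 0 := by
  simp [countOcc, List.countP_cons]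

theorem pairWeight_eq_sum_countOcc {α : Type*} [DecidableEq α] [Fintype α] (f : α → α → ℕ) :
    ∀ u : List α, pairWeight f u = ∑ a, ∑ b, countOcc [a, b] u * f a b
  | [] => by simp [pairWeight, countOcc]
  | [c] => by simp [pairWeight, countOcc]
  | c :: d :: u => by
    rw [pairWeight, pairWeight_eq_sum_countOcc f (d :: u)]
    simp only [countOcc_cons _ c, add_mul, Finset.sum_add_distrib]
    simp [List.isPrefixOf, ite_and, add_comm]

theorem KAbEq.pairWeight_eq {α : Type*} [DecidableEq α] [Fintype α] {u v : List α}
    (h : KAbEq 2 u v) (f : α → α → ℕ) : pairWeight f u = pairWeight f v := by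
  simp only [pairWeight_eq_sum_countOcc, h.2.2 [_, _] rfl]

/-- Scans a word for prefixes `u ++ v` with `u`, `v` of equal length, equal first letter `a` and
equal pair weights. Here `slow` and `fast` are what is left after the current `u` and `u ++ v`,
which have weights `A`, `B` and last letters `x`, `y`. -/
def noSquarePrefix {α : Type*} [DecidableEq α] (f : α → α → ℕ) (a : α) :
    List α → ℕ → ℕ → α → α → List α → Bool
  | [], _, _, _, _, _ => true
  | s :: slow, A, B, x, y, fast =>
    !(decide (s = a) && decide (B = A + (A + f x s))) &&
      match fast with
      | c :: d :: fast => noSquarePrefix f a slow (A + f x s) (B + (f y c + f c d)) s d fast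
      | _ => true

theorem noSquarePrefix_sound {α : Type*} [DecidableEq α] (f : α → α → ℕ) (a : α)
    (z z' : List α) (r : List α) : ∀ (g : List α) (A B : ℕ) (x y : α),
      g.length = 2 * r.length →
      noSquarePrefix f a (r ++ a :: z) A B x y (g ++ z') = true →
      B + pairWeight f (y :: g) ≠
        (A + pairWeight f (x :: r)) + (A + pairWeight f (x :: (r ++ [a]))) := by
  induction r with
  | nil =>
    intro g A B x y hg h
    obtain rfl : g = [] := by simpa using hg
    unfold noSquarePrefix at h
    simpa [pairWeight] using (Bool.and_eq_true_iff.mp h).1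
  | cons s r ih =>
    intro g A B x y hg h
    match g, hg with
    | [], hg => simp at hg
    | [_], hg => simp at hg; omega
    | c :: d :: g, hg =>
      simp only [List.cons_append] at h
      rw [noSquarePrefix, Bool.and_eq_true] at h
      have := ih g _ _ _ _ (by simp at hg; omega) h.2
      simp only [List.cons_append, pairWeight] at this ⊢
      omega

/-- Checks that no suffix of a word starts with a square detected by `noSquarePrefix`. -/
def noSquare {α : Type*} [DecidableEq α] (f : α → α → ℕ) : List α → Bool
  | [] => true
  | [_] => true
  | a :: b :: t => noSquarePrefix f a (b :: t) 0 (f a b) a b t && noSquare f (b :: t)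

theorem noSquarePrefix_of_noSquare_append {α : Type*} [DecidableEq α] (f : α → α → ℕ) (a b : α)
    (t : List α) : ∀ p : List α, noSquare f (p ++ a :: b :: t) = true →
      noSquarePrefix f a (b :: t) 0 (f a b) a b t = true
  | [], h => by
    rw [List.nil_append, noSquare, Bool.and_eq_true] at h
    exact h.1
  | [c], h => by
    rw [List.cons_append, List.nil_append, noSquare, Bool.and_eq_true] at h
    exact noSquarePrefix_of_noSquare_append f a b t [] h.2
  | c :: d :: p, h => by
    rw [List.cons_append, List.cons_append, noSquare, Bool.and_eq_true] at h
    exact noSquarePrefix_of_noSquare_append f a b t (d :: p) h.2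

theorem not_kAbEq_two_of_noSquare {α : Type*} [DecidableEq α] [Fintype α] (f : α → α → ℕ)
    {w : List α} (hw : noSquare f w = true) {u v : List α} (hu : u ≠ []) (hv : v ≠ [])
    (huv : (u ++ v) <:+: w) : ¬ KAbEq 2 u v := by
  intro h
  obtain ⟨p, z, rfl⟩ := huv
  obtain ⟨a, r, rfl⟩ := List.exists_cons_of_ne_nil hu
  obtain ⟨s, v, rfl⟩ := List.exists_cons_of_ne_nil hv
  obtain rfl : a = s := by simpa using h.1
  have hlen : r.length = v.length := by
    simpa [pairWeight_one] using h.pairWeight_eq fun _ _ => 1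
  have hweight := h.pairWeight_eq f
  obtain ⟨b, g, hbg⟩ := List.exists_cons_of_ne_nil (show r ++ a :: v ≠ [] by simp)
  have hg : g.length = 2 * r.length := by
    have := congrArg List.length hbg
    simp at this
    omega
  have hprefix : noSquarePrefix f a (b :: (g ++ z)) 0 (f a b) a b (g ++ z) = true := by
    refine noSquarePrefix_of_noSquare_append f a b (g ++ z) p ?_
    rw [← List.cons_append (a := b), ← hbg]
    simpa using hw
  rw [← List.cons_append (a := b), ← hbg, List.append_assoc, List.cons_append] at hprefix
  refine noSquarePrefix_sound f a _ z r g 0 (f a b) a b hg hprefix ?_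
  have hsplit := pairWeight_append_cons f a v (a :: r)
  rw [List.cons_append, hbg, pairWeight, List.cons_append] at hsplit
  omega

/-- The ternary word of length `n` whose letters are the base-`3` digits of `N`, least significant
first. -/
def ternaryDigits : ℕ → ℕ → List (Fin 3)
  | 0, _ => []
  | n + 1, N => Fin.ofNat 3 N :: ternaryDigits n (N / 3)

theorem length_ternaryDigits : ∀ n N : ℕ, (ternaryDigits n N).length = n
  | 0, _ => rfl
  | n + 1, N => by simp [ternaryDigits, length_ternaryDigits n]

/-- The base-`3` code of a word of length `537` without `2`-abelian squares. -/
def squarefreeCode : ℕ :=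
  3273503171112119615827851903795168088462564877806649044321412421792228638653497295576747188369947590776811308222204736455486262414434997747487657191917045542319490541365911525993015635193352350417417276269349215667521010671712150218699382801237253927414005

/-- Weights of the nine pairs of letters whose sums over words of length below `1024` determine
all pair counts. -/
def packedPair (a b : Fin 3) : ℕ :=
  1024 ^ (3 * a.val + b.val)

theorem noSquare_squarefreeCode :
    noSquare packedPair (ternaryDigits 537 squarefreeCode) = true := by
  decide +kernel

/-- there is a ternary word of length 537 avoiding 2-abelian
squares. -/
theorem exists_ternary_537_twoAbelian_squarefree :
    ∃ w : List (Fin 3), w.length = 537 ∧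
      ∀ u v : List (Fin 3), u ≠ [] → v ≠ [] → (u ++ v) <:+: w → ¬ KAbEq 2 u v :=
  ⟨ternaryDigits 537 squarefreeCode, length_ternaryDigits _ _,
    fun _ _ => not_kAbEq_two_of_noSquare packedPair noSquare_squarefreeCode⟩
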